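/- arXiv:2409.13925 — 11 statements merged into one kernel-verified Lean document; each statement's English description precedes it below -/
import Mathlib

section
/- Let M be a commutative semiring and suppose there is an element 𝔪 ∈ M with 𝔪 ≠ 0 such that a * 𝔪 = 𝔪 for every a ∈ M with a ≠ 0. Then M has no zero divisors: for all b, z ∈ M, if b * z = 0 then b = 0 or z = 0. -/
/-- A commutative semiring with a nonzero multiplicatively absorbing
element `m` (i.e. `a * m = m` for all nonzero `a`) has no zero divisors. -/
theorem stmt_0 {M : Type*} [CommSemiring M] (m : M) (hm : m ≠ 0)
    (habs : ∀ a : M, a ≠ 0 → a * m = m) :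
    ∀ b z : M, b * z = 0 → b = 0 ∨ z = 0 := by
  intro b z hbz
  by_contra! h
  apply hm
  rw [← habs b h.1, ← habs z h.2, ← mul_assoc, hbz, zero_mul]
end

section
/- Let M be a finite additive commutative monoid such that the relation (a ≤ b iff there exists c with a + c = b) is antisymmetric (i.e., the natural preorder is a partial order). Then the element T = ∑_{m ∈ M} m (the sum over all elements of M) is additively absorbing: T + a = T for every a ∈ M. -/
/-- In a finite additive commutative monoid whose natural preorder
(`a ≤ b` iff `∃ c, a + c = b`) is antisymmetric, the sum of all elements is
additively absorbing. -/
theorem stmt_1 {M : Type*} [AddCommMonoid M] [Fintype M]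
    (hanti : ∀ a b : M, (∃ c, a + c = b) → (∃ c, b + c = a) → a = b) :
    ∀ a : M, (∑ m : M, m) + a = ∑ m : M, m := by
  classical
  intro a
  refine hanti _ _ ?_ ⟨a, rfl⟩
  exact ⟨_, Finset.add_sum_erase Finset.univ (fun m : M => m)
    (Finset.mem_univ ((∑ m : M, m) + a))⟩
end

section
/- Let M be a canonically ordered commutative semiring (the natural preorder a ≤ b iff ∃ c, a + c = b is a partial order) possessing an element 𝔪 ≠ 0 with a * 𝔪 = 𝔪 for every a ≠ 0 (an 𝔪-dioid). A family of vectors v : ι → (Fin k → M) is linearly attached over M if and only if it is support-attached. -/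
/-- A family of vectors over a commutative semiring is *linearly attached* if
there exist disjoint finite index sets `A`, `B`, not both empty, and scalars
nonzero on `A ∪ B`, with `∑_{a ∈ A} l a • v a = ∑_{b ∈ B} l b • v b`. -/
def LinAttached {M : Type*} [CommSemiring M] {ι : Type*} {k : ℕ}
    (v : ι → Fin k → M) : Prop :=
  ∃ (A B : Finset ι) (l : ι → M), Disjoint A B ∧ ¬(A = ∅ ∧ B = ∅) ∧
    (∀ i ∈ A, l i ≠ 0) ∧ (∀ i ∈ B, l i ≠ 0) ∧
    ∀ j : Fin k, ∑ a ∈ A, l a * v a j = ∑ b ∈ B, l b * v b j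

/-- A family of vectors is *support-attached* if there exist disjoint finite
index sets `A`, `B`, not both empty, such that in every coordinate the vectors
from `A` and those from `B` have a nonzero entry together. -/
def SupportAttached {M : Type*} [Zero M] {ι : Type*} {k : ℕ}
    (v : ι → Fin k → M) : Prop :=
  ∃ (A B : Finset ι), Disjoint A B ∧ ¬(A = ∅ ∧ B = ∅) ∧
    ∀ j : Fin k, (∃ a ∈ A, v a j ≠ 0) ↔ (∃ b ∈ B, v b j ≠ 0)

section AbsorbingSemiring

variable {M : Type*} [CommSemiring M]

/-- Antisymmetry of the natural preorder makes a semiring zero-sum-free. -/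
theorem eq_zero_of_add_eq_zero_of_antisymm
    (hord : ∀ a b : M, (∃ c, a + c = b) → (∃ c, b + c = a) → a = b)
    {a b : M} (h : a + b = 0) : a = 0 :=
  hord a 0 ⟨b, h⟩ ⟨a, zero_add a⟩

/-- In a zero-sum-free semiring, a finite sum vanishes iff every term does. -/
theorem sum_eq_zero_iff_of_antisymm
    (hord : ∀ a b : M, (∃ c, a + c = b) → (∃ c, b + c = a) → a = b)
    {ι : Type*} (s : Finset ι) (f : ι → M) :
    ∑ i ∈ s, f i = 0 ↔ ∀ i ∈ s, f i = 0 := by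
  classical
  refine ⟨fun h i hi => ?_, Finset.sum_eq_zero⟩
  rw [← Finset.add_sum_erase s f hi] at h
  exact eq_zero_of_add_eq_zero_of_antisymm hord h

/-- A nonzero absorbing element excludes zero divisors. -/
theorem mul_ne_zero_of_absorbing {m : M} (hm : m ≠ 0)
    (habs : ∀ a : M, a ≠ 0 → a * m = m) {a b : M} (ha : a ≠ 0) (hb : b ≠ 0) :
    a * b ≠ 0 := by
  intro h
  apply hm
  rw [← habs a ha, ← habs b hb, ← mul_assoc, h, zero_mul]

/-- A linear combination with nonzero coefficients is nonzero iff one of the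
combined elements is. -/
theorem sum_mul_ne_zero_iff_of_absorbing
    (hord : ∀ a b : M, (∃ c, a + c = b) → (∃ c, b + c = a) → a = b)
    {m : M} (hm : m ≠ 0) (habs : ∀ a : M, a ≠ 0 → a * m = m)
    {ι : Type*} {s : Finset ι} {l : ι → M} (hl : ∀ i ∈ s, l i ≠ 0) (f : ι → M) :
    ∑ i ∈ s, l i * f i ≠ 0 ↔ ∃ i ∈ s, f i ≠ 0 := by
  rw [Ne, sum_eq_zero_iff_of_antisymm hord]
  push Not
  constructor
  · rintro ⟨i, hi, h⟩
    exact ⟨i, hi, right_ne_zero_of_mul h⟩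
  · rintro ⟨i, hi, h⟩
    exact ⟨i, hi, mul_ne_zero_of_absorbing hm habs (hl i hi) h⟩

/-- Summing multiples of the absorbing element gives that element unless all
the factors vanish. -/
theorem sum_absorbing_mul
    (hord : ∀ a b : M, (∃ c, a + c = b) → (∃ c, b + c = a) → a = b)
    {m : M} (habs : ∀ a : M, a ≠ 0 → a * m = m)
    {ι : Type*} {s : Finset ι} {f : ι → M} (h : ∃ i ∈ s, f i ≠ 0) :
    ∑ i ∈ s, m * f i = m := by
  rw [← Finset.mul_sum, mul_comm]
  refine habs _ fun h0 => ?_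
  obtain ⟨i, hi, hne⟩ := h
  exact hne ((sum_eq_zero_iff_of_antisymm hord s f).1 h0 i hi)

end AbsorbingSemiring

/-- Over an 𝔪-dioid (a canonically ordered commutative semiring
with a nonzero multiplicatively absorbing element), a family of vectors is
linearly attached iff it is support-attached. -/
theorem stmt_4 {M : Type*} [CommSemiring M]
    (hord : ∀ a b : M, (∃ c, a + c = b) → (∃ c, b + c = a) → a = b)
    (m : M) (hm : m ≠ 0) (habs : ∀ a : M, a ≠ 0 → a * m = m)
    {ι : Type*} {k : ℕ} (v : ι → Fin k → M) :
    LinAttached v ↔ SupportAttached v := by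
  constructor
  · rintro ⟨A, B, l, hd, hne, hA, hB, h⟩
    refine ⟨A, B, hd, hne, fun j => ?_⟩
    rw [← sum_mul_ne_zero_iff_of_absorbing hord hm habs hA fun i => v i j,
      ← sum_mul_ne_zero_iff_of_absorbing hord hm habs hB fun i => v i j, h j]
  · rintro ⟨A, B, hd, hne, h⟩
    refine ⟨A, B, fun _ => m, hd, hne, fun _ _ => hm, fun _ _ => hm, fun j => ?_⟩
    by_cases hj : ∃ a ∈ A, v a j ≠ 0
    · rw [sum_absorbing_mul hord habs hj, sum_absorbing_mul hord habs ((h j).1 hj)]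
    · have hj' := mt (h j).2 hj
      push Not at hj hj'
      rw [Finset.sum_eq_zero fun a ha => by rw [hj a ha, mul_zero],
        Finset.sum_eq_zero fun b hb => by rw [hj' b hb, mul_zero]]
end

section
/- Let v : ι → (Fin k → ℝ) be a family of vectors each of whose entries lies in {0, 1}. If the family is not linearly independent over ℝ, then it is support-attached: there exist finite subsets A, B of ι that are disjoint and not both empty such that for every coordinate j, (∃ a ∈ A, v a j ≠ 0) ↔ (∃ b ∈ B, v b j ≠ 0). -/
/-- In a vanishing weighted sum of nonnegative reals, a nonzero term of positive weight is
balanced by a nonzero term of negative weight. -/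
theorem exists_neg_weight_of_sum_mul_eq_zero {ι : Type*} {s : Finset ι} {g x : ι → ℝ}
    (hx : ∀ i ∈ s, 0 ≤ x i) (hsum : ∑ i ∈ s, g i * x i = 0)
    {a : ι} (ha : a ∈ s) (hga : 0 < g a) (hxa : x a ≠ 0) :
    ∃ b ∈ s, g b < 0 ∧ x b ≠ 0 := by
  by_contra! h
  have hnonneg : ∀ i ∈ s, 0 ≤ g i * x i := fun i hi => by
    rcases lt_or_ge (g i) 0 with hg | hg
    · simp [h i hi hg]
    · exact mul_nonneg hg (hx i hi)
  exact mul_ne_zero hga.ne' hxa ((Finset.sum_eq_zero_iff_of_nonneg hnonneg).1 hsum a ha)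

/-- A family of 0/1 real vectors that is linearly dependent over ℝ
is support-attached. -/
theorem stmt_5 {ι : Type*} {k : ℕ} (v : ι → Fin k → ℝ)
    (h01 : ∀ i j, v i j = 0 ∨ v i j = 1)
    (hdep : ¬ LinearIndependent ℝ v) :
    SupportAttached v := by
  obtain ⟨s, g, hsum, i, hi, hgi⟩ := not_linearIndependent_iff.1 hdep
  have hv : ∀ i j, 0 ≤ v i j := fun i j => by rcases h01 i j with h | h <;> simp [h]
  have hcoord : ∀ j, ∑ i ∈ s, g i * v i j = 0 := fun j => by
    simpa using congrFun hsum j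
  refine ⟨s.filter (fun i => 0 < g i), s.filter (fun i => g i < 0), ?_, ?_, fun j => ⟨?_, ?_⟩⟩
  · exact Finset.disjoint_filter.2 fun i _ h => h.not_gt
  · rintro ⟨hA, hB⟩
    rcases lt_or_gt_of_ne hgi with h | h
    · exact Finset.filter_eq_empty_iff.1 hB hi h
    · exact Finset.filter_eq_empty_iff.1 hA hi h
  · rintro ⟨a, ha, hva⟩
    obtain ⟨has, hga⟩ := Finset.mem_filter.1 ha
    obtain ⟨b, hb, hgb, hvb⟩ := exists_neg_weight_of_sum_mul_eq_zero
      (x := fun i => v i j) (fun i _ => hv i j) (hcoord j) has hga hva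
    exact ⟨b, Finset.mem_filter.2 ⟨hb, hgb⟩, hvb⟩
  · rintro ⟨b, hb, hvb⟩
    obtain ⟨hbs, hgb⟩ := Finset.mem_filter.1 hb
    obtain ⟨a, ha, hga, hva⟩ := exists_neg_weight_of_sum_mul_eq_zero
      (g := fun i => -g i) (x := fun i => v i j) (fun i _ => hv i j)
      (by simp [hcoord j]) hbs (neg_pos.2 hgb) hvb
    exact ⟨a, Finset.mem_filter.2 ⟨ha, neg_lt_zero.1 hga⟩, hva⟩
end

section
/- Let M be a canonically ordered commutative semiring possessing an element 𝔪 ≠ 0 with a * 𝔪 = 𝔪 for every a ≠ 0 (an 𝔪-dioid). Then every family of k+1 vectors v : Fin (k+1) → (Fin k → M) is linearly attached over M. -/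
/-- A finite sum of copies of `0` and an additive idempotent `m` is `m` as soon as `m` occurs. -/
theorem Finset.sum_ite_idempotent {ι M : Type*} [AddCommMonoid M] {m : M} (hmm : m + m = m)
    (s : Finset ι) (p : ι → Prop) [DecidablePred p] :
    ∑ i ∈ s, (if p i then m else 0) = if ∃ i ∈ s, p i then m else 0 := by
  classical
  induction s using Finset.induction_on with
  | empty => simp
  | insert a s ha ih =>
    rw [Finset.sum_insert ha, ih]
    by_cases h : p a <;> by_cases h' : ∃ i ∈ s, p i <;> simp [h, h', hmm]

/-- If a signed sum of indicators vanishes and an index of negative weight satisfies the predicate,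
then so does an index of positive weight. -/
theorem exists_pos_of_exists_neg_of_sum_eq_zero {ι : Type*} [Fintype ι] {g : ι → ℚ} {p : ι → Prop}
    [DecidablePred p] (h : ∑ i, g i * (if p i then 1 else 0) = 0) :
    (∃ i, g i < 0 ∧ p i) → ∃ i, 0 < g i ∧ p i := by
  rintro ⟨i, hi, hp⟩
  obtain ⟨j, -, hj⟩ := Finset.exists_pos_of_sum_zero_of_exists_nonzero _ h
    ⟨i, Finset.mem_univ i, by simp [hp, hi.ne]⟩
  by_cases hpj : p j
  · exact ⟨j, by simpa [hpj] using hj, hpj⟩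
  · simp [hpj] at hj

/-- If a signed sum of indicators vanishes, then an index of positive weight satisfies the predicate
exactly when an index of negative weight does. -/
theorem exists_pos_iff_exists_neg_of_sum_eq_zero {ι : Type*} [Fintype ι] {g : ι → ℚ} {p : ι → Prop}
    [DecidablePred p] (h : ∑ i, g i * (if p i then 1 else 0) = 0) :
    (∃ i, 0 < g i ∧ p i) ↔ ∃ i, g i < 0 ∧ p i := by
  refine ⟨fun hpos => ?_, exists_pos_of_exists_neg_of_sum_eq_zero h⟩
  have hneg : ∑ i, (-g i) * (if p i then 1 else 0) = 0 := by
    simp only [neg_mul, Finset.sum_neg_distrib, h, neg_zero]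
  simpa using exists_pos_of_exists_neg_of_sum_eq_zero hneg (by simpa using hpos)

/-- Over an 𝔪-dioid, any `k+1` vectors in `M^k` are linearly
attached. -/
theorem stmt_6 {M : Type*} [CommSemiring M]
    (hord : ∀ a b : M, (∃ c, a + c = b) → (∃ c, b + c = a) → a = b)
    (m : M) (hm : m ≠ 0) (habs : ∀ a : M, a ≠ 0 → a * m = m)
    {k : ℕ} (v : Fin (k + 1) → Fin k → M) :
    LinAttached v := by
  classical
  have h_two : (1 + 1 : M) ≠ 0 := fun h => by
    have h_one : (1 : M) = 0 := hord 1 0 ⟨1, h⟩ ⟨1, zero_add 1⟩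
    exact hm (by rw [← mul_one m, h_one, mul_zero])
  have hmm : m + m = m := by rw [← two_mul, ← one_add_one_eq_two, habs _ h_two]
  have hmul : ∀ x : M, m * x = if x ≠ 0 then m else 0 := fun x => by
    by_cases hx : x = 0
    · simp [hx]
    · simp [hx, mul_comm m x, habs x hx]
  have hdep : ¬ LinearIndependent ℚ
      (fun (i : Fin (k + 1)) (j : Fin k) => if v i j ≠ 0 then (1 : ℚ) else 0) := fun h => by
    have hcard := h.fintype_card_le_finrank
    simp at hcard
  obtain ⟨g, hg, i, hi⟩ := Fintype.not_linearIndependent_iff.1 hdep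
  refine ⟨Finset.univ.filter (0 < g ·), Finset.univ.filter (g · < 0), fun _ => m, ?_, ?_,
    fun _ _ => hm, fun _ _ => hm, fun j => ?_⟩
  · exact Finset.disjoint_filter.2 fun _ _ h => h.le.not_gt
  · rintro ⟨hA, hB⟩
    rcases hi.lt_or_gt with h | h
    · exact Finset.filter_eq_empty_iff.1 hB (Finset.mem_univ i) h
    · exact Finset.filter_eq_empty_iff.1 hA (Finset.mem_univ i) h
  · have hj : ∑ i, g i * (if v i j ≠ 0 then (1 : ℚ) else 0) = 0 := by
      simpa only [Finset.sum_apply, Pi.smul_apply, smul_eq_mul, Pi.zero_apply] using congrFun hg j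
    have hiff := exists_pos_iff_exists_neg_of_sum_eq_zero hj
    simp only [hmul, Finset.sum_ite_idempotent hmm, Finset.mem_filter, Finset.mem_univ, true_and,
      hiff]
end

section
/- Let n be a natural number and let F be a finite family of subsets of {1, …, n} (a Finset of Finsets of Fin n) with |F| ≥ n + 1. Then there exist two subfamilies A, B ⊆ F that are disjoint and not both empty such that the union of the sets in A equals the union of the sets in B. -/
/-- If a weighted sum of indicators of sets vanishes at `x` and some set containing `x`
has positive weight, then some set containing `x` has negative weight. -/
theorem exists_neg_of_indicator_sum_eq_zero {α : Type*} [DecidableEq α]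
    {F : Finset (Finset α)} {g : Finset α → ℚ} {x : α}
    (hsum : ∑ S ∈ F, g S * (if x ∈ S then 1 else 0) = 0)
    (hpos : ∃ S ∈ F, 0 < g S ∧ x ∈ S) : ∃ S ∈ F, g S < 0 ∧ x ∈ S := by
  by_contra! h
  obtain ⟨S, hS, hg, hx⟩ := hpos
  have hnonneg : ∀ T ∈ F, 0 ≤ g T * (if x ∈ T then 1 else 0) := by
    intro T hT
    by_cases hxT : x ∈ T
    · have : 0 ≤ g T := not_lt.mp fun hlt => h T hT hlt hxT
      simpa [hxT] using this
    · simp [hxT]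
  have := (Finset.sum_eq_zero_iff_of_nonneg hnonneg).mp hsum S hS
  simp [hx, hg.ne'] at this

/-- Any family of at least `n+1` subsets of `{1, …, n}` contains
two disjoint subfamilies, not both empty, with equal unions. -/
theorem stmt_7 {n : ℕ} (F : Finset (Finset (Fin n))) (hF : F.card ≥ n + 1) :
    ∃ A B : Finset (Finset (Fin n)), A ⊆ F ∧ B ⊆ F ∧ Disjoint A B ∧
      ¬(A = ∅ ∧ B = ∅) ∧ A.sup id = B.sup id := by
  have hdep : ¬ LinearIndepOn ℚ
      (fun (S : Finset (Fin n)) (x : Fin n) => if x ∈ S then (1 : ℚ) else 0)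
      (F : Set (Finset (Fin n))) := by
    intro h
    have := LinearIndependent.fintype_card_le_finrank h
    simp at this
    omega
  rw [linearIndepOn_finset_iff] at hdep
  push Not at hdep
  obtain ⟨g, hg, S, hS, hgS⟩ := hdep
  have hsum (x : Fin n) : ∑ S ∈ F, g S * (if x ∈ S then 1 else 0) = 0 := by
    simpa only [Finset.sum_apply, Pi.smul_apply, smul_eq_mul, Pi.zero_apply] using congrFun hg x
  have hsum_neg (x : Fin n) : ∑ S ∈ F, -g S * (if x ∈ S then 1 else 0) = 0 := by
    simp only [neg_mul, Finset.sum_neg_distrib, hsum, neg_zero]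
  refine ⟨F.filter (0 < g ·), F.filter (g · < 0), Finset.filter_subset _ _,
    Finset.filter_subset _ _, ?_, ?_, ?_⟩
  · exact Finset.disjoint_filter.mpr fun T _ hT => hT.le.not_gt
  · rintro ⟨hA, hB⟩
    rcases hgS.lt_or_gt with h | h
    · exact Finset.filter_eq_empty_iff.mp hB hS h
    · exact Finset.filter_eq_empty_iff.mp hA hS h
  · ext x
    simp only [Finset.mem_sup, Finset.mem_filter, id_eq, and_assoc]
    constructor
    · exact exists_neg_of_indicator_sum_eq_zero (hsum x)
    · intro h
      simpa using exists_neg_of_indicator_sum_eq_zero (g := fun S => -g S) (hsum_neg x)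
        (by simpa using h)
end

section
/- Let n be a natural number and S : Fin n → Finset (Fin n) a family of n subsets of {1, …, n}. Let M be the real incidence matrix given by M i j = 1 if j ∈ S i and M i j = 0 otherwise. If det M = 0 (as a real determinant), then there exist disjoint finite index sets A, B ⊆ Fin n, not both empty, such that the union ⋃_{a ∈ A} S a equals the union ⋃_{b ∈ B} S b. -/
/-- If a linear combination of incidence vectors vanishes, then every element covered by a set with
positive coefficient is also covered by a set with negative coefficient. -/
theorem sup_pos_le_sup_neg {ι α : Type*} [Fintype ι] [DecidableEq α] (S : ι → Finset α)
    (v : ι → ℝ) (hv : ∀ j, ∑ i, v i * (if j ∈ S i then 1 else 0) = 0) :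
    (Finset.univ.filter fun i => 0 < v i).sup S ≤ (Finset.univ.filter fun i => v i < 0).sup S := by
  intro j hj
  simp only [Finset.mem_sup, Finset.mem_filter, Finset.mem_univ, true_and] at hj ⊢
  obtain ⟨a, ha, hja⟩ := hj
  by_contra! hneg
  have hnonneg : ∀ i ∈ Finset.univ, 0 ≤ v i * (if j ∈ S i then (1 : ℝ) else 0) := by
    intro i _
    split_ifs with hji
    · rw [mul_one]
      exact not_lt.mp fun hi => hneg i hi hji
    · simp
  have hzero := (Finset.sum_eq_zero_iff_of_nonneg hnonneg).mp (hv j) a (Finset.mem_univ a)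
  rw [if_pos hja, mul_one] at hzero
  exact ha.ne' hzero


/-- If the real incidence matrix of a family of `n` subsets of
`{1, …, n}` has determinant `0`, then there are two disjoint subfamilies, not
both empty, with equal unions. -/
theorem stmt_8 {n : ℕ} (S : Fin n → Finset (Fin n))
    (M : Matrix (Fin n) (Fin n) ℝ)
    (hM : ∀ i j, M i j = if j ∈ S i then 1 else 0)
    (hdet : M.det = 0) :
    ∃ A B : Finset (Fin n), Disjoint A B ∧ ¬(A = ∅ ∧ B = ∅) ∧
      A.sup S = B.sup S := by
  obtain ⟨v, hv0, hv⟩ := Matrix.exists_vecMul_eq_zero_iff.mpr hdet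
  have hsum : ∀ j, ∑ i, v i * (if j ∈ S i then 1 else 0) = 0 := by
    intro j
    simpa only [Matrix.vecMul, dotProduct, hM, Pi.zero_apply] using congrFun hv j
  refine ⟨Finset.univ.filter fun i => 0 < v i, Finset.univ.filter fun i => v i < 0, ?_, ?_,
    le_antisymm (sup_pos_le_sup_neg S v hsum) ?_⟩
  · exact Finset.disjoint_filter.mpr fun i _ hi => not_lt.mpr hi.le
  · rintro ⟨hA, hB⟩
    refine hv0 (funext fun i => le_antisymm ?_ ?_)
    · exact not_lt.mp (Finset.filter_eq_empty_iff.mp hA (Finset.mem_univ i))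
    · exact not_lt.mp (Finset.filter_eq_empty_iff.mp hB (Finset.mem_univ i))
  · simpa using sup_pos_le_sup_neg S (-v) fun j => by
      simpa only [Pi.neg_apply, neg_mul, Finset.sum_neg_distrib, neg_eq_zero] using hsum j
end

section
/- Let S : ι → Finset (Fin k) be a family of subsets of {1, …, k} and suppose there are finite index sets A, B ⊆ ι that are disjoint and not both empty such that ⋃_{a ∈ A} S a = ⋃_{b ∈ B} S b. Then there exists a family of natural-number vectors u : ι → (Fin k → ℕ) such that for all i and j, u i j ≠ 0 iff j ∈ S i, and for every coordinate j, ∑_{a ∈ A} u a j = ∑_{b ∈ B} u b j. -/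
/-- A linear attachment of Boolean vectors (given by equal unions
of disjoint subfamilies of supports) lifts to a linear attachment of
natural-number vectors with the same supports. -/
theorem stmt_9 {ι : Type*} {k : ℕ} (S : ι → Finset (Fin k))
    (A B : Finset ι) (hdisj : Disjoint A B) (hne : ¬(A = ∅ ∧ B = ∅))
    (hunion : A.sup S = B.sup S) :
    ∃ u : ι → Fin k → ℕ,
      (∀ i j, u i j ≠ 0 ↔ j ∈ S i) ∧
      ∀ j : Fin k, ∑ a ∈ A, u a j = ∑ b ∈ B, u b j := by
  classical
  have hmem (j : Fin k) : (∃ a ∈ A, j ∈ S a) ↔ ∃ b ∈ B, j ∈ S b := by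
    rw [← Finset.mem_sup, ← Finset.mem_sup, hunion]
  -- Weight each vector by the number of vectors on the other side sharing the coordinate.
  let c (T : Finset ι) (j : Fin k) : ℕ := (T.filter fun i => j ∈ S i).card
  have hc (T : Finset ι) (j : Fin k) (h : ∃ i ∈ T, j ∈ S i) : c T j ≠ 0 := by
    obtain ⟨i, hi, hj⟩ := h
    exact Finset.card_ne_zero_of_mem (Finset.mem_filter.2 ⟨hi, hj⟩)
  refine ⟨fun i j => if j ∈ S i then
    (if i ∈ A then c B j else if i ∈ B then c A j else 1) else 0, fun i j => ?_, fun j => ?_⟩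
  · by_cases hj : j ∈ S i
    · simp only [hj, if_true, iff_true]
      split_ifs with hA hB
      · exact hc B j ((hmem j).1 ⟨i, hA, hj⟩)
      · exact hc A j ((hmem j).2 ⟨i, hB, hj⟩)
      · exact one_ne_zero
    · simp [hj]
  · calc
      _ = ∑ a ∈ A, if j ∈ S a then c B j else 0 :=
        Finset.sum_congr rfl fun a ha => by simp [ha]
      _ = c A j * c B j := by
        rw [← Finset.sum_filter, Finset.sum_const, smul_eq_mul]
      _ = c B j * c A j := mul_comm _ _
      _ = ∑ b ∈ B, if j ∈ S b then c A j else 0 := by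
        rw [← Finset.sum_filter, Finset.sum_const, smul_eq_mul]
      _ = _ := Finset.sum_congr rfl fun b hb => by
        simp [hb, Finset.disjoint_right.1 hdisj hb]
end

section
/- Let A be an n × n matrix with entries in ℕ, each entry equal to 0 or 1 (a Boolean matrix). Define det⁺A = ∑_{σ even permutation of Fin n} ∏_i A i (σ i) and det⁻A = ∑_{σ odd permutation of Fin n} ∏_i A i (σ i), computed in ℕ. Then the columns of A are support-attached — i.e., there exist disjoint finite sets of column indices J₁, J₂ ⊆ Fin n, not both empty, such that for every row i, (∃ j ∈ J₁, A i j ≠ 0) ↔ (∃ j ∈ J₂, A i j ≠ 0) — if and only if (det⁺A = 0 ↔ det⁻A = 0). -/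
/-- The positive determinant: sum of diagonal products over even permutations. -/
def detPlus {M : Type*} [CommSemiring M] {n : ℕ} (A : Matrix (Fin n) (Fin n) M) : M :=
  ∑ σ ∈ Finset.univ.filter (fun σ : Equiv.Perm (Fin n) => Equiv.Perm.sign σ = 1),
    ∏ i, A i (σ i)

/-- The negative determinant: sum of diagonal products over odd permutations. -/
def detMinus {M : Type*} [CommSemiring M] {n : ℕ} (A : Matrix (Fin n) (Fin n) M) : M :=
  ∑ σ ∈ Finset.univ.filter (fun σ : Equiv.Perm (Fin n) => Equiv.Perm.sign σ = -1),
    ∏ i, A i (σ i)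

open Matrix in
theorem det_eq_detPlus_sub_detMinus {R : Type*} [CommRing R] {n : ℕ}
    (A : Matrix (Fin n) (Fin n) R) : A.det = detPlus A - detMinus A := by
  rw [← det_transpose, det_apply', detPlus, detMinus, Finset.sum_filter, Finset.sum_filter,
    ← Finset.sum_sub_distrib]
  refine Finset.sum_congr rfl fun σ _ => ?_
  rcases Int.units_eq_one_or (Equiv.Perm.sign σ) with h | h <;> simp [h]

section ZeroCriterion

variable {M : Type*} [CommSemiring M] [PartialOrder M] [IsStrictOrderedRing M] [NoZeroDivisors M]
  {n : ℕ} {A : Matrix (Fin n) (Fin n) M}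

theorem detPlus_eq_zero_iff (hA : ∀ i j, 0 ≤ A i j) :
    detPlus A = 0 ↔ ∀ σ : Equiv.Perm (Fin n), Equiv.Perm.sign σ = 1 → ∃ i, A i (σ i) = 0 := by
  rw [detPlus, Finset.sum_eq_zero_iff_of_nonneg fun σ _ => Finset.prod_nonneg fun i _ => hA _ _]
  simp [Finset.prod_eq_zero_iff]

theorem detMinus_eq_zero_iff (hA : ∀ i j, 0 ≤ A i j) :
    detMinus A = 0 ↔ ∀ σ : Equiv.Perm (Fin n), Equiv.Perm.sign σ = -1 → ∃ i, A i (σ i) = 0 := by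
  rw [detMinus, Finset.sum_eq_zero_iff_of_nonneg fun σ _ => Finset.prod_nonneg fun i _ => hA _ _]
  simp [Finset.prod_eq_zero_iff]

end ZeroCriterion

/-- The nonnegative real matrices with the same zero entries as `A`. -/
def patternClass {n : ℕ} (A : Matrix (Fin n) (Fin n) ℕ) : Set (Matrix (Fin n) (Fin n) ℝ) :=
  {B | ∀ i j, 0 ≤ B i j ∧ (B i j = 0 ↔ A i j = 0)}

section PatternClass

variable {n : ℕ} {A : Matrix (Fin n) (Fin n) ℕ}

theorem detPlus_eq_zero_iff_of_mem_patternClass {B : Matrix (Fin n) (Fin n) ℝ}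
    (hB : B ∈ patternClass A) : detPlus B = 0 ↔ detPlus A = 0 := by
  rw [detPlus_eq_zero_iff fun i j => (hB i j).1, detPlus_eq_zero_iff fun i j => Nat.zero_le _]
  simp only [(hB _ _).2]

theorem detMinus_eq_zero_iff_of_mem_patternClass {B : Matrix (Fin n) (Fin n) ℝ}
    (hB : B ∈ patternClass A) : detMinus B = 0 ↔ detMinus A = 0 := by
  rw [detMinus_eq_zero_iff fun i j => (hB i j).1, detMinus_eq_zero_iff fun i j => Nat.zero_le _]
  simp only [(hB _ _).2]

theorem natCast_mem_patternClass : A.map (Nat.cast : ℕ → ℝ) ∈ patternClass A :=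
  fun i j => by simp

theorem convex_patternClass : Convex ℝ (patternClass A) := by
  intro B hB C hC s t hs ht hst i j
  have hB' := hB i j
  have hC' := hC i j
  simp only [Matrix.add_apply, Matrix.smul_apply, smul_eq_mul]
  have h₁ := mul_nonneg hs hB'.1
  have h₂ := mul_nonneg ht hC'.1
  refine ⟨add_nonneg h₁ h₂, ?_⟩
  rw [add_eq_zero_iff_of_nonneg h₁ h₂, mul_eq_zero, mul_eq_zero, hB'.2, hC'.2]
  constructor
  · rintro ⟨h | h, h' | h'⟩
    · linarith
    all_goals assumption
  · exact fun h => ⟨Or.inr h, Or.inr h⟩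

/-- A nonzero diagonal of `A` can be made to dominate the determinant. -/
theorem exists_mem_patternClass_sign_mul_det_pos {σ : Equiv.Perm (Fin n)}
    (hσ : ∀ i, A i (σ i) ≠ 0) :
    ∃ B ∈ patternClass A, 0 < ((Equiv.Perm.sign σ : ℤ) : ℝ) * B.det := by
  let F : ℝ → Matrix (Fin n) (Fin n) ℝ := fun t =>
    Matrix.of fun i j => if A i j = 0 then 0 else if σ i = j then 1 else t
  have hF : Continuous F := by
    refine continuous_matrix fun i j => ?_
    simp only [F, Matrix.of_apply]
    split_ifs <;> fun_prop
  have hF0 : F 0 = σ.permMatrix ℝ := by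
    ext i j
    by_cases h : σ i = j
    · subst h
      simp [F, hσ, Equiv.Perm.permMatrix, PEquiv.toMatrix_apply]
    · simp [F, h, Equiv.Perm.permMatrix, PEquiv.toMatrix_apply]
  have hpos : 0 < ((Equiv.Perm.sign σ : ℤ) : ℝ) * (F 0).det := by
    rw [hF0, Matrix.det_permutation]
    rcases Int.units_eq_one_or (Equiv.Perm.sign σ) with h | h <;> simp [h]
  have hcont : Continuous fun t => ((Equiv.Perm.sign σ : ℤ) : ℝ) * (F t).det :=
    continuous_const.mul hF.matrix_det
  have hev := hcont.continuousAt.eventually (lt_mem_nhds hpos)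
  obtain ⟨t, hdet, ht⟩ :=
    ((hev.filter_mono nhdsWithin_le_nhds).and (self_mem_nhdsWithin (s := Set.Ioi (0 : ℝ)))).exists
  have ht : 0 < t := ht
  refine ⟨F t, fun i j => ?_, hdet⟩
  simp only [F, Matrix.of_apply]
  split_ifs with h₁ h₂
  · simp [h₁]
  · simp [h₁]
  · simp [h₁, ht.le, ht.ne']

theorem exists_mem_patternClass_det_eq_zero_iff :
    (∃ B ∈ patternClass A, B.det = 0) ↔ (detPlus A = 0 ↔ detMinus A = 0) := by
  constructor
  · rintro ⟨B, hB, hdet⟩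
    rw [det_eq_detPlus_sub_detMinus, sub_eq_zero] at hdet
    rw [← detPlus_eq_zero_iff_of_mem_patternClass hB,
      ← detMinus_eq_zero_iff_of_mem_patternClass hB, hdet]
  · intro h
    by_cases h₀ : detPlus A = 0
    · have hA := natCast_mem_patternClass (A := A)
      refine ⟨_, hA, ?_⟩
      rw [det_eq_detPlus_sub_detMinus, (detPlus_eq_zero_iff_of_mem_patternClass hA).2 h₀,
        (detMinus_eq_zero_iff_of_mem_patternClass hA).2 (h.1 h₀), sub_zero]
    · have h₁ : detMinus A ≠ 0 := fun h' => h₀ (h.2 h')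
      rw [detPlus_eq_zero_iff fun i j => Nat.zero_le _] at h₀
      rw [ne_eq, detMinus_eq_zero_iff fun i j => Nat.zero_le _] at h₁
      push Not at h₀ h₁
      obtain ⟨σ, hσ, hσA⟩ := h₀
      obtain ⟨τ, hτ, hτA⟩ := h₁
      obtain ⟨B, hB, hBdet⟩ := exists_mem_patternClass_sign_mul_det_pos hσA
      obtain ⟨C, hC, hCdet⟩ := exists_mem_patternClass_sign_mul_det_pos hτA
      have hBpos : 0 < B.det := by simpa [hσ] using hBdet
      have hCneg : C.det < 0 := by simpa [hτ] using hCdet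
      obtain ⟨D, hD, hDdet⟩ := convex_patternClass.isPreconnected.intermediate_value hC hB
        (continuous_id.matrix_det).continuousOn ⟨hCneg.le, hBpos.le⟩
      exact ⟨D, hD, hDdet⟩

/-- The columns of `A` are support-attached iff its pattern class contains a singular matrix. -/
theorem supportAttached_iff_exists_mem_patternClass_det_eq_zero :
    (∃ J₁ J₂ : Finset (Fin n), Disjoint J₁ J₂ ∧ ¬(J₁ = ∅ ∧ J₂ = ∅) ∧
        ∀ i : Fin n, (∃ j ∈ J₁, A i j ≠ 0) ↔ (∃ j ∈ J₂, A i j ≠ 0)) ↔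
      ∃ B ∈ patternClass A, B.det = 0 := by
  constructor
  · rintro ⟨J₁, J₂, hdisj, hne, hJ⟩
    let r (J : Finset (Fin n)) (i : Fin n) : ℝ := ∑ j ∈ J, (A i j : ℝ)
    have hr (J : Finset (Fin n)) (i : Fin n) : 0 ≤ r J i :=
      Finset.sum_nonneg fun j _ => Nat.cast_nonneg _
    have hr0 (J : Finset (Fin n)) (i : Fin n) : r J i ≠ 0 ↔ ∃ j ∈ J, A i j ≠ 0 := by
      simp only [r, ne_eq]
      rw [Finset.sum_eq_zero_iff_of_nonneg fun j _ => Nat.cast_nonneg _]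
      simp
    let B : Matrix (Fin n) (Fin n) ℝ := Matrix.of fun i j =>
      A i j * if j ∈ J₁ then r J₂ i else if j ∈ J₂ then r J₁ i else 1
    have hB : B ∈ patternClass A := by
      intro i j
      simp only [B, Matrix.of_apply]
      refine ⟨mul_nonneg (Nat.cast_nonneg _) (by split_ifs <;> simp [hr]), ?_⟩
      rw [mul_eq_zero, Nat.cast_eq_zero, or_iff_left_iff_imp]
      contrapose
      intro hA
      split_ifs with h₁ h₂
      · exact (hr0 _ _).2 ((hJ i).1 ⟨j, h₁, hA⟩)
      · exact (hr0 _ _).2 ((hJ i).2 ⟨j, h₂, hA⟩)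
      · exact one_ne_zero
    refine ⟨B, hB, Matrix.exists_mulVec_eq_zero_iff.1
      ⟨fun j => (if j ∈ J₁ then 1 else 0) - if j ∈ J₂ then 1 else 0, fun hv => hne ?_, ?_⟩⟩
    · have hv' (j : Fin n) : j ∉ J₁ ∧ j ∉ J₂ := by
        have h := congrFun hv j
        by_cases h₁ : j ∈ J₁
        · simp [h₁, Finset.disjoint_left.1 hdisj h₁] at h
        · by_cases h₂ : j ∈ J₂ <;> simp_all
      exact ⟨Finset.eq_empty_of_forall_notMem fun j => (hv' j).1,
        Finset.eq_empty_of_forall_notMem fun j => (hv' j).2⟩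
    · ext i
      have h₁ : ∑ j ∈ J₁, B i j = r J₁ i * r J₂ i := by
        rw [Finset.sum_mul]
        exact Finset.sum_congr rfl fun j hj => by simp [B, hj]
      have h₂ : ∑ j ∈ J₂, B i j = r J₂ i * r J₁ i := by
        rw [Finset.sum_mul]
        exact Finset.sum_congr rfl fun j hj => by
          simp [B, hj, Finset.disjoint_right.1 hdisj hj]
      simp [Matrix.mulVec, dotProduct, mul_sub, Finset.sum_sub_distrib, h₁, h₂,
        mul_comm (r J₂ i)]
  · rintro ⟨B, hB, hdet⟩
    obtain ⟨v, hv, hBv⟩ := Matrix.exists_mulVec_eq_zero_iff.2 hdet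
    have hpos {i j : Fin n} (h : A i j ≠ 0) : 0 < B i j :=
      (hB i j).1.lt_of_ne' (mt (hB i j).2.1 h)
    have hrow (w : Fin n → ℝ) (hw : B.mulVec w = 0) (i : Fin n)
        (h : ∃ j, 0 < w j ∧ A i j ≠ 0) : ∃ j, w j < 0 ∧ A i j ≠ 0 := by
      obtain ⟨j, hj, hA⟩ := h
      by_contra! hneg
      have hsum : ∑ k, B i k * w k = 0 := congrFun hw i
      rw [Finset.sum_eq_zero_iff_of_nonneg] at hsum
      · exact (mul_pos (hpos hA) hj).ne' (hsum j (Finset.mem_univ j))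
      · intro k _
        rcases lt_or_ge (w k) 0 with hk | hk
        · simp [(hB i k).2.2 (hneg k hk)]
        · exact mul_nonneg (hB i k).1 hk
    refine ⟨Finset.univ.filter (0 < v ·), Finset.univ.filter (v · < 0), ?_, ?_, fun i => ?_⟩
    · exact Finset.disjoint_filter.2 fun j _ h h' => lt_asymm h h'
    · rintro ⟨h₁, h₂⟩
      refine hv (funext fun j => ?_)
      have h₁ := Finset.filter_eq_empty_iff.1 h₁ (Finset.mem_univ j)
      have h₂ := Finset.filter_eq_empty_iff.1 h₂ (Finset.mem_univ j)
      exact le_antisymm (not_lt.1 h₁) (not_lt.1 h₂)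
    · simp only [Finset.mem_filter, Finset.mem_univ, true_and]
      refine ⟨hrow v hBv i, fun h => ?_⟩
      simpa using hrow (-v) (by rw [Matrix.mulVec_neg, hBv, neg_zero]) i (by simpa using h)

end PatternClass

/-- For an `n × n` 0/1 matrix over ℕ, the columns are
support-attached iff `det⁺A` and `det⁻A` are both zero or both nonzero. -/
theorem stmt_10 {n : ℕ} (A : Matrix (Fin n) (Fin n) ℕ)
    (h01 : ∀ i j, A i j = 0 ∨ A i j = 1) :
    (∃ J₁ J₂ : Finset (Fin n), Disjoint J₁ J₂ ∧ ¬(J₁ = ∅ ∧ J₂ = ∅) ∧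
        ∀ i : Fin n, (∃ j ∈ J₁, A i j ≠ 0) ↔ (∃ j ∈ J₂, A i j ≠ 0)) ↔
      (detPlus A = 0 ↔ detMinus A = 0) := by
  exact supportAttached_iff_exists_mem_patternClass_det_eq_zero.trans
    exists_mem_patternClass_det_eq_zero_iff
end

section
/- Let M be a canonically ordered commutative semiring possessing an element 𝔪 ≠ 0 with a * 𝔪 = 𝔪 for every a ≠ 0 (an 𝔪-dioid), and let A be an n × n matrix with entries in M. Define det⁺A = ∑_{σ even permutation of Fin n} ∏_i A i (σ i) and det⁻A = ∑_{σ odd permutation} ∏_i A i (σ i). Then the columns of A (the family fun j => fun i => A i j) are linearly attached over M if and only if (det⁺A = 0 ↔ det⁻A = 0), i.e., det⁺A and det⁻A are both zero or both nonzero. -/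
open Finset in
theorem detPlus_sub_detMinus {R : Type*} [CommRing R] {n : ℕ} (X : Matrix (Fin n) (Fin n) R) :
    detPlus X - detMinus X = X.det := by
  have hodd : univ.filter (fun σ : Equiv.Perm (Fin n) => Equiv.Perm.sign σ = -1) =
      univ.filter (fun σ : Equiv.Perm (Fin n) => ¬ Equiv.Perm.sign σ = 1) := by
    ext σ
    rcases Int.units_eq_one_or (Equiv.Perm.sign σ) with h | h <;> simp [h]
  rw [← Matrix.det_transpose, Matrix.det_apply', detPlus, detMinus, hodd,
    ← sum_filter_add_sum_filter_not univ (fun σ : Equiv.Perm (Fin n) => Equiv.Perm.sign σ = 1),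
    sub_eq_add_neg, ← sum_neg_distrib]
  congr 1 <;> refine sum_congr rfl fun σ hσ => ?_
  · simp [(mem_filter.1 hσ).2]
  · simp [(Int.units_eq_one_or (Equiv.Perm.sign σ)).resolve_left (mem_filter.1 hσ).2]

/-- A nonnegative real matrix with the same zero pattern as `A`. -/
def IsRealPattern {M : Type*} [Zero M] {n : ℕ} (A : Matrix (Fin n) (Fin n) M)
    (X : Matrix (Fin n) (Fin n) ℝ) : Prop :=
  ∀ i j, (A i j = 0 → X i j = 0) ∧ (A i j ≠ 0 → 0 < X i j)

namespace IsRealPattern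

variable {M : Type*} {n : ℕ}

theorem nonneg [Zero M] {A : Matrix (Fin n) (Fin n) M} {X : Matrix (Fin n) (Fin n) ℝ}
    (h : IsRealPattern A X) (i j : Fin n) : 0 ≤ X i j := by
  by_cases hA : A i j = 0
  · exact ((h i j).1 hA).ge
  · exact ((h i j).2 hA).le

theorem eq_zero_iff [Zero M] {A : Matrix (Fin n) (Fin n) M} {X : Matrix (Fin n) (Fin n) ℝ}
    (h : IsRealPattern A X) (i j : Fin n) : X i j = 0 ↔ A i j = 0 :=
  ⟨fun hX => by_contra fun hA => ((h i j).2 hA).ne' hX, (h i j).1⟩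

theorem convex [Zero M] (A : Matrix (Fin n) (Fin n) M) : Convex ℝ {X | IsRealPattern A X} := by
  intro X hX Y hY a b ha hb hab i j
  simp only [Matrix.add_apply, Matrix.smul_apply, smul_eq_mul]
  refine ⟨fun h => by simp [(hX i j).1 h, (hY i j).1 h], fun h => ?_⟩
  have hx := (hX i j).2 h
  have hy := (hY i j).2 h
  rcases ha.eq_or_lt with rfl | ha
  · obtain rfl : b = 1 := by linarith
    simpa using hy
  · have := mul_pos ha hx
    have := mul_nonneg hb hy.le
    linarith

theorem sum_prod_eq_zero_iff [CommSemiring M] [NoZeroDivisors M] [Nontrivial M]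
    [Subsingleton (AddUnits M)] {A : Matrix (Fin n) (Fin n) M} {X : Matrix (Fin n) (Fin n) ℝ}
    (h : IsRealPattern A X) (s : Finset (Equiv.Perm (Fin n))) :
    ∑ σ ∈ s, ∏ i, X i (σ i) = 0 ↔ ∑ σ ∈ s, ∏ i, A i (σ i) = 0 := by
  rw [Finset.sum_eq_zero_iff_of_nonneg fun σ _ => Finset.prod_nonneg fun i _ => h.nonneg _ _,
    Finset.sum_eq_zero_iff]
  simp only [Finset.prod_eq_zero_iff, h.eq_zero_iff]

/-- If a permutation lies in the support of `A`, some real matrix with the pattern of `A` has a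
determinant of the same sign as that permutation. -/
theorem exists_sign_mul_det_pos [Zero M] {A : Matrix (Fin n) (Fin n) M}
    {σ : Equiv.Perm (Fin n)} (hσ : ∀ i, A i (σ i) ≠ 0) :
    ∃ X, IsRealPattern A X ∧ 0 < ((Equiv.Perm.sign σ : ℤ) : ℝ) * X.det := by
  classical
  let Q : Matrix (Fin n) (Fin n) ℝ := A.map fun a => if a = 0 then 0 else 1
  let P : Matrix (Fin n) (Fin n) ℝ := σ.permMatrix ℝ
  let f : ℝ → ℝ := fun t => ((Equiv.Perm.sign σ : ℤ) : ℝ) * (P + t • Q).det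
  have hf : Continuous f := by fun_prop
  have hf0 : 0 < f 0 := by
    rcases Int.units_eq_one_or (Equiv.Perm.sign σ) with h | h <;>
      simp [f, P, Matrix.det_permutation, h]
  have hev : ∀ᶠ t in nhdsWithin (0 : ℝ) (Set.Ioi 0), 0 < f t :=
    nhdsWithin_le_nhds (hf.continuousAt.eventually (lt_mem_nhds hf0))
  obtain ⟨t, hft, ht⟩ := (hev.and self_mem_nhdsWithin).exists
  refine ⟨P + t • Q, fun i j => ⟨fun h => ?_, fun h => ?_⟩, hft⟩
  · have : σ i ≠ j := by rintro rfl; exact hσ i h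
    simp [P, Q, h, Equiv.Perm.permMatrix, PEquiv.toMatrix_apply, this]
  · have h1 : 0 ≤ P i j := by
      simp only [P, Equiv.Perm.permMatrix, PEquiv.toMatrix_apply]
      split_ifs <;> simp
    have h2 : (0 : ℝ) < t := ht
    simp only [Matrix.add_apply, Matrix.smul_apply, Q, Matrix.map_apply, h, if_false, smul_eq_mul, mul_one]
    linarith

theorem exists_det_eq_zero_iff [CommSemiring M] [NoZeroDivisors M] [Nontrivial M]
    [Subsingleton (AddUnits M)] (A : Matrix (Fin n) (Fin n) M) :
    (∃ X, IsRealPattern A X ∧ X.det = 0) ↔ (detPlus A = 0 ↔ detMinus A = 0) := by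
  have key : ∀ X, IsRealPattern A X →
      ((detPlus X = 0 ↔ detPlus A = 0) ∧ (detMinus X = 0 ↔ detMinus A = 0)) :=
    fun X hX => ⟨hX.sum_prod_eq_zero_iff _, hX.sum_prod_eq_zero_iff _⟩
  constructor
  · rintro ⟨X, hX, hdet⟩
    rw [← detPlus_sub_detMinus, sub_eq_zero] at hdet
    rw [← (key X hX).1, ← (key X hX).2, hdet]
  · intro h
    by_cases hp : detPlus A = 0
    · classical
      let Q : Matrix (Fin n) (Fin n) ℝ := A.map fun a => if a = 0 then 0 else 1
      have hQ : IsRealPattern A Q := fun i j => ⟨fun h => by simp [Q, h], fun h => by simp [Q, h]⟩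
      refine ⟨Q, hQ, ?_⟩
      rw [← detPlus_sub_detMinus, (key Q hQ).1.2 hp, (key Q hQ).2.2 (h.1 hp), sub_zero]
    · have hm := mt h.2 hp
      obtain ⟨σ, hσ, hσA⟩ := Finset.exists_ne_zero_of_sum_ne_zero hp
      obtain ⟨τ, hτ, hτA⟩ := Finset.exists_ne_zero_of_sum_ne_zero hm
      rw [Finset.prod_ne_zero_iff] at hσA hτA
      obtain ⟨X, hX, hXdet⟩ := exists_sign_mul_det_pos fun i => hσA i (Finset.mem_univ i)
      obtain ⟨Y, hY, hYdet⟩ := exists_sign_mul_det_pos fun i => hτA i (Finset.mem_univ i)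
      simp only [(Finset.mem_filter.1 hσ).2, (Finset.mem_filter.1 hτ).2] at hXdet hYdet
      have hcont : Continuous fun Z : Matrix (Fin n) (Fin n) ℝ => Z.det := by fun_prop
      obtain ⟨Z, hZ, hZdet⟩ := (convex A).isPreconnected.intermediate_value hY hX
        hcont.continuousOn (show (0 : ℝ) ∈ Set.Icc Y.det X.det from by
          constructor <;> simp at hXdet hYdet <;> linarith)
      exact ⟨Z, hZ, hZdet⟩

end IsRealPattern

section Attached

variable {M : Type*} [CommSemiring M] {n : ℕ}

/-- A family is linearly attached as soon as the supports of two disjoint subfamilies cover the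
same coordinates, and conversely. -/
theorem linAttached_iff_support [NoZeroDivisors M] [Subsingleton (AddUnits M)]
    {m : M} (hm : m ≠ 0) (habs : ∀ a : M, a ≠ 0 → a * m = m) {ι : Type*} (v : ι → Fin n → M) :
    LinAttached v ↔ ∃ S T : Finset ι, Disjoint S T ∧ ¬(S = ∅ ∧ T = ∅) ∧
      ∀ j, (∀ a ∈ S, v a j = 0) ↔ ∀ b ∈ T, v b j = 0 := by
  constructor
  · rintro ⟨S, T, l, hd, hne, hS, hT, h⟩
    refine ⟨S, T, hd, hne, fun j => ?_⟩
    have h0 : ∀ U : Finset ι, (∀ i ∈ U, l i ≠ 0) →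
        (∑ a ∈ U, l a * v a j = 0 ↔ ∀ a ∈ U, v a j = 0) := fun U hU => by
      rw [Finset.sum_eq_zero_iff]
      exact forall₂_congr fun a ha => by simp [hU a ha]
    rw [← h0 S hS, ← h0 T hT, h j]
  · rintro ⟨S, T, hd, hne, h⟩
    refine ⟨S, T, fun _ => m, hd, hne, fun _ _ => hm, fun _ _ => hm, fun j => ?_⟩
    rw [← Finset.mul_sum, ← Finset.mul_sum, mul_comm m, mul_comm m]
    have hST : ∑ a ∈ S, v a j = 0 ↔ ∑ b ∈ T, v b j = 0 := by
      simpa only [Finset.sum_eq_zero_iff] using h j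
    by_cases hS : ∑ a ∈ S, v a j = 0
    · rw [hS, hST.1 hS]
    · rw [habs _ hS, habs _ (mt hST.2 hS)]

theorem exists_support_iff_exists_det_eq_zero (A : Matrix (Fin n) (Fin n) M) :
    (∃ S T : Finset (Fin n), Disjoint S T ∧ ¬(S = ∅ ∧ T = ∅) ∧
      ∀ i, (∀ a ∈ S, A i a = 0) ↔ ∀ b ∈ T, A i b = 0) ↔
    ∃ X, IsRealPattern A X ∧ X.det = 0 := by
  classical
  constructor
  · rintro ⟨S, T, hd, hne, h⟩
    let c : Finset (Fin n) → Fin n → ℝ := fun U i => ((U.filter fun a => A i a ≠ 0).card : ℝ)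
    let X : Matrix (Fin n) (Fin n) ℝ := fun i j =>
      if A i j = 0 then 0 else if j ∈ S then (c S i)⁻¹ else if j ∈ T then (c T i)⁻¹ else 1
    let x : Fin n → ℝ := fun j => if j ∈ S then 1 else if j ∈ T then -1 else 0
    have hc : ∀ U i j, j ∈ U → A i j ≠ 0 → 0 < c U i := fun U i j hj hA =>
      Nat.cast_pos.2 (Finset.card_pos.2 ⟨j, Finset.mem_filter.2 ⟨hj, hA⟩⟩)
    have hsum : ∀ U i, ∑ j, (if j ∈ U ∧ A i j ≠ 0 then (c U i)⁻¹ else 0) =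
        if ∀ a ∈ U, A i a = 0 then 0 else 1 := by
      intro U i
      have hfilter : (Finset.univ.filter fun j => j ∈ U ∧ A i j ≠ 0) =
          U.filter fun j => A i j ≠ 0 := by ext; simp
      rw [← Finset.sum_filter, hfilter, Finset.sum_const, nsmul_eq_mul]
      split_ifs with hU
      · rw [Finset.filter_false_of_mem fun a ha => not_not.2 (hU a ha)]
        simp
      · push Not at hU
        obtain ⟨a, ha, hA⟩ := hU
        exact mul_inv_cancel₀ (hc U i a ha hA).ne'
    refine ⟨X, fun i j => ⟨fun hA => if_pos hA, fun hA => ?_⟩,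
      Matrix.exists_mulVec_eq_zero_iff.1 ⟨x, ?_, ?_⟩⟩
    · simp only [X, if_neg hA]
      split_ifs with hS hT
      · exact inv_pos.2 (hc S i j hS hA)
      · exact inv_pos.2 (hc T i j hT hA)
      · exact one_pos
    · intro hx
      refine hne ⟨Finset.eq_empty_of_forall_notMem fun j hj => ?_,
        Finset.eq_empty_of_forall_notMem fun j hj => ?_⟩
      · simpa [x, hj] using congrFun hx j
      · simpa [x, hj, Finset.disjoint_right.1 hd hj] using congrFun hx j
    · funext i
      have hterm : ∀ j, X i j * x j = (if j ∈ S ∧ A i j ≠ 0 then (c S i)⁻¹ else 0) -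
          (if j ∈ T ∧ A i j ≠ 0 then (c T i)⁻¹ else 0) := by
        intro j
        have hST : j ∈ S → j ∉ T := fun hj => Finset.disjoint_left.1 hd hj
        by_cases hA : A i j = 0
        · simp [X, hA]
        · by_cases hS : j ∈ S
          · simp [X, x, hA, hS, hST hS]
          · by_cases hT : j ∈ T <;> simp [X, x, hA, hS, hT]
      simp only [Matrix.mulVec, dotProduct, hterm, Finset.sum_sub_distrib, hsum, h i, sub_self,
        Pi.zero_apply]
  · rintro ⟨X, hX, hdet⟩
    obtain ⟨x, hx, hXx⟩ := Matrix.exists_mulVec_eq_zero_iff.2 hdet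
    have hvanish : ∀ (y : Fin n → ℝ), X.mulVec y = 0 → ∀ i, (∀ j, 0 < y j → A i j = 0) →
        ∀ j, y j < 0 → A i j = 0 := by
      intro y hy i hi j hj
      have hle : ∀ k ∈ Finset.univ, X i k * y k ≤ 0 := fun k _ => by
        rcases lt_or_ge 0 (y k) with hk | hk
        · rw [(hX i k).1 (hi k hk), zero_mul]
        · exact mul_nonpos_of_nonneg_of_nonpos (hX.nonneg i k) hk
      have h0 := (Finset.sum_eq_zero_iff_of_nonpos hle).1 (congrFun hy i) j (Finset.mem_univ j)
      exact (hX.eq_zero_iff i j).1 ((mul_eq_zero.1 h0).resolve_right hj.ne)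
    refine ⟨Finset.univ.filter fun j => 0 < x j, Finset.univ.filter fun j => x j < 0, ?_, ?_, ?_⟩
    · exact Finset.disjoint_filter.2 fun j _ h => h.not_gt
    · rintro ⟨hS, hT⟩
      refine hx (funext fun j => le_antisymm ?_ ?_)
      · simpa using (Finset.filter_eq_empty_iff.1 hS (Finset.mem_univ j))
      · simpa using (Finset.filter_eq_empty_iff.1 hT (Finset.mem_univ j))
    · intro i
      simp only [Finset.mem_filter, Finset.mem_univ, true_and]
      refine ⟨hvanish x hXx i, fun h j hj => ?_⟩
      exact hvanish (-x) (by rw [Matrix.mulVec_neg, hXx, neg_zero]) i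
        (fun k hk => h k (by simpa using hk)) j (by simpa using hj)

end Attached

/-- Over an 𝔪-dioid `M`, the columns of an `n × n` matrix are
linearly attached iff `det⁺A` and `det⁻A` are both zero or both nonzero. -/
theorem stmt_12 {M : Type*} [CommSemiring M]
    (hord : ∀ a b : M, (∃ c, a + c = b) → (∃ c, b + c = a) → a = b)
    (m : M) (hm : m ≠ 0) (habs : ∀ a : M, a ≠ 0 → a * m = m)
    {n : ℕ} (A : Matrix (Fin n) (Fin n) M) :
    LinAttached (fun j => fun i => A i j) ↔ (detPlus A = 0 ↔ detMinus A = 0) := by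
  have : Nontrivial M := ⟨m, 0, hm⟩
  have : NoZeroDivisors M := ⟨fun {a b} hab => by
    by_contra! hne
    apply hm
    rw [← habs a hne.1, ← habs b hne.2, ← mul_assoc, hab, zero_mul]⟩
  have : Subsingleton (AddUnits M) := ⟨fun u w => AddUnits.ext <| by
    have h0 (u : AddUnits M) : (u : M) = 0 := hord _ _ ⟨_, u.add_neg⟩ ⟨u, zero_add _⟩
    rw [h0, h0]⟩
  rw [linAttached_iff_support hm habs, exists_support_iff_exists_det_eq_zero,
    IsRealPattern.exists_det_eq_zero_iff]
end

section
/- Let n be a natural number and F a finite family of subsets of {1, …, n} (a Finset of Finsets of Fin n) with |F| ≥ n, such that F has the distinct union property: any two distinct subfamilies A, B ⊆ F satisfy ⋃ A ≠ ⋃ B (equivalently, A.sup id = B.sup id implies A = B). Then F is exactly the family of all singletons, F = { {i} : i ∈ Fin n }. -/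
/-- In a family with the distinct union property, each member has an element lying in no
other member. -/
theorem exists_private_element {α : Type*} [DecidableEq α] (F : Finset (Finset α))
    (hdup : ∀ A B : Finset (Finset α), A ⊆ F → B ⊆ F → A.sup id = B.sup id → A = B)
    {S : Finset α} (hS : S ∈ F) : ∃ x ∈ S, ∀ T ∈ F, x ∈ T → T = S := by
  by_contra! h
  have hsup : (F.erase S).sup id = F.sup id := by
    refine le_antisymm (Finset.sup_mono (Finset.erase_subset S F)) (Finset.sup_le ?_)
    intro T hT x hx
    rw [Finset.mem_sup]
    by_cases hTS : T = S
    · subst hTS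
      obtain ⟨U, hU, hxU, hne⟩ := h x hx
      exact ⟨U, Finset.mem_erase.2 ⟨hne, hU⟩, hxU⟩
    · exact ⟨T, Finset.mem_erase.2 ⟨hTS, hT⟩, hx⟩
  have heq := hdup _ _ (Finset.erase_subset S F) subset_rfl hsup
  exact Finset.notMem_erase S F (heq.symm ▸ hS)

/-- A family of at least `n` subsets of `{1, …, n}` with the
distinct union property (distinct subfamilies have distinct unions) is exactly
the family of all singletons. -/
theorem stmt_14 {n : ℕ} (F : Finset (Finset (Fin n))) (hF : F.card ≥ n)
    (hdup : ∀ A B : Finset (Finset (Fin n)), A ⊆ F → B ⊆ F →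
      A.sup id = B.sup id → A = B) :
    F = (Finset.univ : Finset (Fin n)).image (fun i => ({i} : Finset (Fin n))) := by
  have h : ∀ S : F, ∃ x ∈ S.1, ∀ T ∈ F, x ∈ T → T = S.1 :=
    fun S => exists_private_element F hdup S.2
  choose x hxS hx using h
  have hinj : Function.Injective x := fun S T hST =>
    Subtype.ext (hx T S.1 S.2 (hST ▸ hxS S))
  have hsurj : Function.Surjective x := by
    refine ((Fintype.bijective_iff_injective_and_card x).2 ⟨hinj, ?_⟩).2
    refine le_antisymm (Fintype.card_le_of_injective x hinj) ?_
    simpa using hF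
  have hsingle : ∀ S : F, S.1 = {x S} := by
    intro S
    refine Finset.eq_singleton_iff_unique_mem.2 ⟨hxS S, fun j hj => ?_⟩
    obtain ⟨T, rfl⟩ := hsurj j
    rw [Subtype.ext (hx T S.1 S.2 hj)]
  ext S
  simp only [Finset.mem_image, Finset.mem_univ, true_and]
  constructor
  · intro hS
    exact ⟨x ⟨S, hS⟩, (hsingle ⟨S, hS⟩).symm⟩
  · rintro ⟨i, rfl⟩
    obtain ⟨T, rfl⟩ := hsurj i
    exact hsingle T ▸ T.2
end
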